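/- arXiv:1505.03883 — 2 statements merged into one kernel-verified Lean document; each statement's English description precedes it below -/
import Mathlib

section
/- Let k ≥ 2 be an integer and let α > 0 and β > 0 be reals with α + β ≥ 1, α_i ≤ α and β_i C_i ≤ β U_i t_k for all i = 1,…,k−1, and suppose U_k > 0 is a real with C_k/t_k = β·U_k. If either (i) (k−1)·α > 2β and Σ_{i=1}^{k} U_i ≤ ((k−1)/k) · (α + β − √(α² + β² − 2αβ/(k−1)))/(αβ), or (ii) (k−1)·α ≤ 2β and Σ_{i=1}^{k} U_i ≤ 1/β − (k−1)·α/(2kβ²), then the k-point last-release test passes. -/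
open Finset

lemma aux_sum (U : ℕ → ℝ) (n : ℕ) :
    2 * ∑ i ∈ Finset.Icc 1 n, U i * ∑ l ∈ Finset.Icc 1 (i - 1), U l
      + ∑ i ∈ Finset.Icc 1 n, U i ^ 2 = (∑ i ∈ Finset.Icc 1 n, U i) ^ 2 := by
  induction n with
  | zero => simp
  | succ n ih =>
    rw [Finset.sum_Icc_succ_top (by omega), Finset.sum_Icc_succ_top (by omega),
      Finset.sum_Icc_succ_top (by omega)]
    simp only [Nat.add_sub_cancel]
    linarith

lemma aux_real (n a b W V : ℝ) (hn : 1 ≤ n) (ha : 0 < a) (hb : 0 < b) (hV : 0 < V)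
    (hcond : (n * a > 2 * b ∧ W + V ≤ (n / (n + 1)) *
        ((a + b - Real.sqrt (a ^ 2 + b ^ 2 - 2 * a * b / n)) / (a * b))) ∨
      (n * a ≤ 2 * b ∧ W + V ≤ 1 / b - n * a / (2 * (n + 1) * b ^ 2))) :
    a * W < 1 ∧ b * V ≤ 1 - (a + b) * W + a * b * W ^ 2 * ((n + 1) / (2 * n)) := by
  have hn0 : 0 < n := by linarith
  rcases hcond with ⟨h1, h2⟩ | ⟨h1, h2⟩
  · set s := Real.sqrt (a ^ 2 + b ^ 2 - 2 * a * b / n) with hs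
    have hD : 2 * a * b / n ≤ a ^ 2 := by
      rw [div_le_iff₀ hn0]; nlinarith
    have hsb : b ≤ s := Real.le_sqrt_of_sq_le (by linarith)
    have hsa : a - b / n ≤ s := by
      apply Real.le_sqrt_of_sq_le
      have e : (a - b / n) ^ 2 = a ^ 2 - 2 * a * b / n + (b / n) ^ 2 := by ring
      have : b / n ≤ b := div_le_self hb.le hn
      have : (b / n) ^ 2 ≤ b ^ 2 := by gcongr
      linarith
    have hs2 : s ^ 2 = a ^ 2 + b ^ 2 - 2 * a * b / n := Real.sq_sqrt (by nlinarith [sq_nonneg b])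
    set c := (n + 1) / (2 * n) with hc
    have hc0 : 0 < c := by positivity
    have hc1 : c = 1 / 2 + 1 / (2 * n) := by rw [hc]; field_simp
    set X := (n / (n + 1)) * ((a + b - s) / (a * b)) with hX
    have hX1 : a * b * c * X = (a + b - s) / 2 := by
      rw [hX, hc]; field_simp
    have hroot : 1 - (a + b) * X + a * b * c * X ^ 2 = 0 := by
      have h4 : 4 * (a * b * c) * (1 - (a + b) * X + a * b * c * X ^ 2) = 0 := by
        have : 4 * (a * b * c) * (1 - (a + b) * X + a * b * c * X ^ 2) =
          4 * (a * b * c) - 4 * (a + b) * (a * b * c * X) + 4 * (a * b * c * X) ^ 2 := by ring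
        rw [this, hX1]
        have : 4 * (a * b * c) = 2 * a * b + 2 * a * b / n := by rw [hc1]; ring
        rw [this]
        nlinarith
      have : 4 * (a * b * c) ≠ 0 := by positivity
      exact (mul_eq_zero.mp h4).resolve_left this
    have hWX : W < X := by linarith
    have habc : 0 < a * b * c := by positivity
    have hlt : a * b * c * W < a * b * c * X := mul_lt_mul_of_pos_left hWX habc
    constructor
    · have : b * c = b / 2 + (b / n) / 2 := by rw [hc1]; field_simp
      have h5 : b * c * (a * W) < b * c * 1 := by nlinarith
      exact lt_of_mul_lt_mul_left h5 (by positivity)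
    · have h6 : 0 ≤ (X - W) * (a - a * b * c * (W + X)) :=
        mul_nonneg (by linarith) (by nlinarith)
      nlinarith
  · have key : b * (W + V) ≤ 1 - n * a / (2 * (n + 1) * b) := by
      have := mul_le_mul_of_nonneg_left h2 hb.le
      have e : b * (1 / b - n * a / (2 * (n + 1) * b ^ 2)) = 1 - n * a / (2 * (n + 1) * b) := by
        field_simp
      linarith
    constructor
    · have hbW : b * W < 1 - n * a / (2 * (n + 1) * b) := by nlinarith
      have h7 : a * (1 - n * a / (2 * (n + 1) * b)) ≤ b := by
        have e : b - a * (1 - n * a / (2 * (n + 1) * b)) =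
          (2 * (n + 1) * b ^ 2 - 2 * (n + 1) * a * b + n * a ^ 2) / (2 * (n + 1) * b) := by
          field_simp
          ring
        have : 0 ≤ b - a * (1 - n * a / (2 * (n + 1) * b)) := by
          rw [e]
          apply div_nonneg _ (by positivity)
          have : 0 ≤ (n * a - (n + 1) * b) ^ 2 + (n ^ 2 - 1) * b ^ 2 :=
            add_nonneg (sq_nonneg _) (mul_nonneg (by nlinarith) (sq_nonneg _))
          have : 0 ≤ n * (2 * (n + 1) * b ^ 2 - 2 * (n + 1) * a * b + n * a ^ 2) := by
            nlinarith
          exact nonneg_of_mul_nonneg_right this hn0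
        linarith
      have : b * (a * W) < b * 1 := by nlinarith
      exact lt_of_mul_lt_mul_left this hb.le
    · have e : 1 - a * W + a * b * W ^ 2 * ((n + 1) / (2 * n)) - (1 - n * a / (2 * (n + 1) * b))
        = a * b * ((n + 1) / (2 * n)) * (W - n / ((n + 1) * b)) ^ 2 := by
        field_simp
        ring
      have : 0 ≤ a * b * ((n + 1) / (2 * n)) * (W - n / ((n + 1) * b)) ^ 2 := by positivity
      linarith

/-- Lemma 6 of the k²Q framework: with C_k/t_k = β·U_k, the two-case bound on
Σ_{i=1}^{k} U_i implies that the k-point last-release test passes, provided α + β ≥ 1. -/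
theorem stmt7 (k : ℕ) (hk : 2 ≤ k) (α β U C : ℕ → ℝ)
    (hα : ∀ i ∈ Finset.Icc 1 (k - 1), 0 < α i)
    (hβ : ∀ i ∈ Finset.Icc 1 (k - 1), 0 < β i)
    (hU : ∀ i ∈ Finset.Icc 1 (k - 1), 0 < U i)
    (hC : ∀ i ∈ Finset.Icc 1 (k - 1), 0 ≤ C i)
    (Ck tk Uk : ℝ) (hCk : 0 < Ck) (htk : 0 < tk) (hUk : 0 < Uk)
    (a b : ℝ) (ha : 0 < a) (hb : 0 < b) (hab : 1 ≤ a + b)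
    (hαa : ∀ i ∈ Finset.Icc 1 (k - 1), α i ≤ a)
    (hβb : ∀ i ∈ Finset.Icc 1 (k - 1), β i * C i ≤ b * U i * tk)
    (hCkUk : Ck / tk = b * Uk)
    (hcond :
      (((k : ℝ) - 1) * a > 2 * b ∧
        (∑ i ∈ Finset.Icc 1 (k - 1), U i) + Uk ≤
          (((k : ℝ) - 1) / k) *
            ((a + b - Real.sqrt (a ^ 2 + b ^ 2 - 2 * a * b / ((k : ℝ) - 1))) / (a * b)))
      ∨
      (((k : ℝ) - 1) * a ≤ 2 * b ∧
        (∑ i ∈ Finset.Icc 1 (k - 1), U i) + Uk ≤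
          1 / b - ((k : ℝ) - 1) * a / (2 * (k : ℝ) * b ^ 2))) :
    ∀ t : ℕ → ℝ, t k = tk → 0 ≤ t 1 →
      (∀ i, 1 ≤ i → i < k → t i ≤ t (i + 1)) →
      ∃ j ∈ Finset.Icc 1 k,
        Ck + (∑ i ∈ Finset.Icc 1 (k - 1), α i * t i * U i)
          + (∑ i ∈ Finset.Icc 1 (j - 1), β i * C i) ≤ t j := by

  intro t htk' ht1 hmono
  by_contra hcon
  push Not at hcon
  obtain ⟨n, rfl⟩ : ∃ n, k = n + 1 := ⟨k - 1, by omega⟩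
  simp only [Nat.add_sub_cancel] at *
  have hn1 : (1 : ℝ) ≤ n := by exact_mod_cast (by omega : 1 ≤ n)
  have hn0 : (0 : ℝ) < n := by linarith
  have ecast : ((n + 1 : ℕ) : ℝ) - 1 = n := by push_cast; ring
  rw [ecast] at hcond
  push_cast at hcond
  set W := ∑ i ∈ Finset.Icc 1 n, U i with hW
  obtain ⟨haW, hfin⟩ := aux_real n a b W Uk hn1 ha hb hUk hcond
  have hCk' : Ck = b * Uk * tk := by
    rw [div_eq_iff htk.ne'] at hCkUk; exact hCkUk
  have htn : ∀ i, 1 ≤ i → i ≤ n + 1 → 0 ≤ t i := by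
    intro i hi
    induction i, hi using Nat.le_induction with
    | base => intro _; exact ht1
    | succ m hm ih => intro h; exact (ih (by omega)).trans (hmono m hm (by omega))
  set S := Ck + ∑ i ∈ Finset.Icc 1 n, α i * t i * U i with hS
  have hB : ∀ j, 1 ≤ j → j ≤ n + 1 → t j < S + b * tk * ∑ i ∈ Finset.Icc 1 (j - 1), U i := by
    intro j h1 h2
    refine (hcon j (Finset.mem_Icc.mpr ⟨h1, h2⟩)).trans_le ?_
    gcongr
    rw [Finset.mul_sum]
    apply Finset.sum_le_sum
    intro i hi
    rw [Finset.mem_Icc] at hi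
    have := hβb i (Finset.mem_Icc.mpr ⟨hi.1, by omega⟩)
    linarith
  have hlast := hB (n + 1) (by omega) le_rfl
  simp only [Nat.add_sub_cancel] at hlast
  rw [htk', ← hW] at hlast
  have hsum : ∑ i ∈ Finset.Icc 1 n, α i * t i * U i ≤
      a * W * S + a * b * tk * ∑ i ∈ Finset.Icc 1 n, U i * ∑ l ∈ Finset.Icc 1 (i - 1), U l := by
    rw [hW, Finset.mul_sum, Finset.sum_mul, Finset.mul_sum, ← Finset.sum_add_distrib]
    apply Finset.sum_le_sum
    intro i hi
    have hu := hU i hi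
    have hal := hαa i hi
    rw [Finset.mem_Icc] at hi
    have ht0 := htn i hi.1 (by omega)
    calc α i * t i * U i ≤ a * t i * U i := by gcongr
      _ ≤ a * (S + b * tk * ∑ l ∈ Finset.Icc 1 (i - 1), U l) * U i := by
        have := (hB i hi.1 (by omega)).le
        gcongr
      _ = _ := by ring
  have hq := aux_sum U n
  have hcs := sq_sum_le_card_mul_sum_sq (s := Finset.Icc 1 n) (f := U)
  simp only [Nat.card_Icc, Nat.add_sub_cancel] at hcs
  rw [← hW] at hq hcs
  set Q := ∑ i ∈ Finset.Icc 1 n, U i * ∑ l ∈ Finset.Icc 1 (i - 1), U l with hQ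
  have hQle : Q ≤ W ^ 2 * (1 - (n + 1) / (2 * n)) := by
    have e : W ^ 2 * (1 - (n + 1) / (2 * n)) = (W ^ 2 - W ^ 2 / (n : ℝ)) / 2 := by
      field_simp; ring
    have : W ^ 2 / (n : ℝ) ≤ ∑ i ∈ Finset.Icc 1 n, U i ^ 2 := by
      rw [div_le_iff₀ hn0]; linarith
    rw [e]; linarith
  have h1 : (tk - b * tk * W) * (1 - a * W) < S * (1 - a * W) :=
    mul_lt_mul_of_pos_right (by linarith) (by linarith)
  have h2 : S * (1 - a * W) ≤ b * Uk * tk + a * b * tk * Q := by linarith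
  have h3 : a * b * tk * Q ≤ a * b * tk * (W ^ 2 * (1 - (n + 1) / (2 * n))) := by gcongr
  have h4 := mul_le_mul_of_nonneg_left hfin htk.le
  linarith
end

section
/- Let k ≥ 2 be an integer; for i = 1,…,k−1 let T_i > 0 and C_i ≥ 0 be reals with U_i = C_i/T_i and T_i ≤ T_k (rate-monotonic priority ordering); let T_k > 0, C_k > 0, U_k = C_k/T_k, D > 0, and set β = T_k/D. Assume Σ_{i=1}^{k} U_i ≤ 1. If either (i) k > 2β + 1 and Σ_{i=1}^{k} U_i ≤ ((k−1)/(β·k)) · (1 + β − √(1 + β² − 2β/(k−1))), or (ii) k ≤ 2β + 1 and Σ_{i=1}^{k} U_i ≤ 1/β − (k−1)/(2β²·k), then for every integer h ≥ 1 there exists a real t with 0 < t ≤ (h−1)·T_k + D such that h·C_k + Σ_{i=1}^{k-1} ⌈t/T_i⌉ · C_i ≤ t. -/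
open Finset

theorem aux_pairs (s : Finset ℕ) (t U : ℕ → ℝ) (hU : ∀ i ∈ s, 0 ≤ U i) :
    2 * ∑ i ∈ s, U i * ∑ j ∈ s, (if t j < t i then U j else 0)
      ≤ (∑ i ∈ s, U i) ^ 2 - ∑ i ∈ s, U i ^ 2 := by
  have h1 : ∑ i ∈ s, U i * ∑ j ∈ s, (if t j < t i then U j else 0)
      = ∑ i ∈ s, ∑ j ∈ s, (if t j < t i then U i * U j else 0) := by
    refine Finset.sum_congr rfl fun i _ => ?_
    rw [Finset.mul_sum]
    refine Finset.sum_congr rfl fun j _ => ?_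
    split_ifs <;> simp
  have h2 : ∑ i ∈ s, ∑ j ∈ s, (if t j < t i then U i * U j else 0)
      = ∑ i ∈ s, ∑ j ∈ s, (if t i < t j then U i * U j else 0) := by
    rw [Finset.sum_comm]
    refine Finset.sum_congr rfl fun i _ => Finset.sum_congr rfl fun j _ => ?_
    rw [mul_comm]
  have h3 : ∑ i ∈ s, U i ^ 2 = ∑ i ∈ s, ∑ j ∈ s, (if i = j then U i * U j else 0) := by
    refine Finset.sum_congr rfl fun i hi => ?_
    rw [Finset.sum_ite_eq]
    simp [hi, sq]
  have h4 : ∑ i ∈ s, ∑ j ∈ s, (if t j < t i then U i * U j else 0)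
      + ∑ i ∈ s, ∑ j ∈ s, (if t i < t j then U i * U j else 0)
      + ∑ i ∈ s, ∑ j ∈ s, (if i = j then U i * U j else 0) ≤ (∑ i ∈ s, U i) ^ 2 := by
    rw [sq, Finset.sum_mul_sum, ← Finset.sum_add_distrib, ← Finset.sum_add_distrib]
    refine Finset.sum_le_sum fun i hi => ?_
    rw [← Finset.sum_add_distrib, ← Finset.sum_add_distrib]
    refine Finset.sum_le_sum fun j hj => ?_
    have hp := mul_nonneg (hU i hi) (hU j hj)
    by_cases hij : i = j
    · subst hij; simp
    · rcases lt_trichotomy (t i) (t j) with h | h | h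
      · simp [hij, h, h.le, not_lt.mpr h.le]
      · simp [hij, h, hp]
      · simp [hij, h, not_lt.mpr h.le]
  rw [h1, h3]
  linarith

theorem aux_final (n β S V q : ℝ) (hn : 1 ≤ n) (hβ : 0 < β) (hVS : V < S)
    (hq : V ^ 2 ≤ n * q) (hS : (1 - V) / β + (V ^ 2 + q) / 2 < S)
    (hc : (n > 2 * β ∧ S ≤ (n / (β * (n + 1))) * (1 + β - Real.sqrt (1 + β ^ 2 - 2 * β / n)))
      ∨ S ≤ 1 / β - n / (2 * β ^ 2 * (n + 1))) : False := by
  have hn0 : 0 < n := by linarith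
  obtain ⟨c, hcdef⟩ : ∃ c, c = (n + 1) / n := ⟨_, rfl⟩
  have hc0 : 0 < c := by rw [hcdef]; positivity
  have hq' : V ^ 2 * c ≤ V ^ 2 + q := by
    have : V ^ 2 / n ≤ q := by rw [div_le_iff₀ hn0]; linarith
    have e : V ^ 2 * c = V ^ 2 + V ^ 2 / n := by rw [hcdef]; field_simp
    linarith
  have hS' : (1 - V) / β + V ^ 2 * c / 2 < S := by linarith
  obtain ⟨b, hb⟩ : ∃ b, b = 1 / β := ⟨_, rfl⟩
  have hb0 : 0 < b := by rw [hb]; positivity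
  have hbβ : b * β = 1 := by rw [hb]; field_simp
  have e1 : (1 - V) / β = (1 - V) * b := by rw [hb]; ring
  rw [e1] at hS'
  obtain ⟨m, hm⟩ : ∃ m, m = b / c := ⟨_, rfl⟩
  have hmc : m * c = b := by rw [hm]; field_simp
  have hm0 : 0 < m := by rw [hm]; positivity
  rcases hc with ⟨h1, h2⟩ | h2
  · have hdisc : β ^ 2 ≤ 1 + β ^ 2 - 2 * β / n := by
      have : 2 * β / n ≤ 1 := by rw [div_le_one hn0]; linarith
      linarith
    obtain ⟨r, hr⟩ : ∃ r, r = Real.sqrt (1 + β ^ 2 - 2 * β / n) := ⟨_, rfl⟩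
    have hrβ : β ≤ r := by rw [hr]; exact Real.le_sqrt_of_sq_le hdisc
    have hr2 : r ^ 2 = 1 + β ^ 2 - 2 * β / n := by
      rw [hr]; exact Real.sq_sqrt (le_trans (sq_nonneg β) hdisc)
    have hr2' : r ^ 2 = (1 + β) ^ 2 - 2 * β * c := by
      rw [hr2, hcdef]; field_simp; ring
    rw [← hr] at h2
    have e2 : n / (β * (n + 1)) = m := by rw [hm, hb, hcdef]; field_simp
    rw [e2] at h2
    have hSm : S ≤ m := by nlinarith
    have hmono : (1 - S) * b + S ^ 2 * c / 2 ≤ (1 - V) * b + V ^ 2 * c / 2 := by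
      have : (S - V) * (c * (2 * m - S - V)) ≥ 0 :=
        mul_nonneg (by linarith) (mul_nonneg hc0.le (by linarith))
      have e : (S - V) * (c * (2 * m - S - V))
        = 2 * (m * c) * (S - V) - c * (S ^ 2 - V ^ 2) := by ring
      rw [e, hmc] at this
      linarith
    have hlt : (1 - S) * b + S ^ 2 * c / 2 < S := by linarith
    have hlt2 : c * (S - m * (1 + β - r)) * (S - m * (1 + β + r)) < 0 := by
      have e : c * (S - m * (1 + β - r)) * (S - m * (1 + β + r))
        = c * S ^ 2 - 2 * S * (m * c) * (1 + β) + m * (m * c) * ((1 + β) ^ 2 - r ^ 2) := by ring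
      have e3 : m * (m * c) * (2 * β * c) = 2 * b := by
        calc m * (m * c) * (2 * β * c) = 2 * (m * c) * ((m * c) * β) := by ring
          _ = 2 * b := by rw [hmc, hbβ]; ring
      have e4 : (1 + β) ^ 2 - r ^ 2 = 2 * β * c := by rw [hr2']; ring
      rw [e, e4, e3, hmc]
      have e5 : 2 * S * b * (1 + β) = 2 * S * b + 2 * S * (b * β) := by ring
      rw [e5, hbβ]
      linarith
    have : m * (1 + β - r) ≤ m * (1 + β + r) := by
      apply mul_le_mul_of_nonneg_left _ hm0.le
      linarith
    have h7 : 0 ≤ c * ((m * (1 + β - r) - S) * (m * (1 + β + r) - S)) :=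
      mul_nonneg hc0.le (mul_nonneg (by linarith) (by linarith))
    nlinarith
  · have e2 : 1 / β - n / (2 * β ^ 2 * (n + 1)) = b - b * m / 2 := by
      rw [hm, hb, hcdef]; field_simp
    rw [e2] at h2
    have : 0 ≤ c * (V - m) ^ 2 := by positivity
    have e : c * (V - m) ^ 2 = c * V ^ 2 - 2 * (m * c) * V + (m * c) * m := by ring
    rw [e, hmc] at this
    linarith

/-- Corollary 2, second bound, of the paper: the two-case total utilization bound for
rate-monotonic scheduling with arbitrary deadline D (β = T_k/D) implies that task τ_k
meets its relative deadline D. -/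
theorem stmt15 (k : ℕ) (hk : 2 ≤ k)
    (T C U : ℕ → ℝ)
    (hT : ∀ i ∈ Finset.Icc 1 (k - 1), 0 < T i)
    (hC : ∀ i ∈ Finset.Icc 1 (k - 1), 0 ≤ C i)
    (hU : ∀ i ∈ Finset.Icc 1 (k - 1), U i = C i / T i)
    (Tk Ck Uk D : ℝ) (hTk : 0 < Tk) (hCk : 0 < Ck) (hUk : Uk = Ck / Tk) (hD : 0 < D)
    (hRM : ∀ i ∈ Finset.Icc 1 (k - 1), T i ≤ Tk)
    (β : ℝ) (hβ : β = Tk / D)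
    (hsumU : (∑ i ∈ Finset.Icc 1 (k - 1), U i) + Uk ≤ 1)
    (hcond :
      ((k : ℝ) > 2 * β + 1 ∧
        (∑ i ∈ Finset.Icc 1 (k - 1), U i) + Uk ≤
          (((k : ℝ) - 1) / (β * k)) *
            (1 + β - Real.sqrt (1 + β ^ 2 - 2 * β / ((k : ℝ) - 1))))
      ∨
      ((k : ℝ) ≤ 2 * β + 1 ∧
        (∑ i ∈ Finset.Icc 1 (k - 1), U i) + Uk ≤
          1 / β - ((k : ℝ) - 1) / (2 * β ^ 2 * k))) :
    ∀ h : ℕ, 1 ≤ h →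
      ∃ t : ℝ, 0 < t ∧ t ≤ ((h : ℝ) - 1) * Tk + D ∧
        (h : ℝ) * Ck + (∑ i ∈ Finset.Icc 1 (k - 1), (⌈t / T i⌉ : ℝ) * C i) ≤ t := by
  intro h hh
  by_contra hcon
  push Not at hcon
  obtain ⟨s, hs⟩ : ∃ s, s = Finset.Icc 1 (k - 1) := ⟨_, rfl⟩
  rw [← hs] at hT hC hU hRM hsumU hcond
  simp only [← hs] at hcon
  have hh1 : (1 : ℝ) ≤ h := by exact_mod_cast hh
  obtain ⟨tk, htk⟩ : ∃ tk, tk = ((h : ℝ) - 1) * Tk + D := ⟨_, rfl⟩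
  rw [← htk] at hcon
  have htk0 : 0 < tk := by
    rw [htk]; have := mul_nonneg (sub_nonneg.mpr hh1) hTk.le; linarith
  have hU0 : ∀ i ∈ s, 0 ≤ U i := fun i hi => by
    rw [hU i hi]; exact div_nonneg (hC i hi) (hT i hi).le
  have hCU : ∀ i ∈ s, C i = U i * T i := fun i hi => by
    rw [hU i hi, div_mul_cancel₀ _ (hT i hi).ne']
  obtain ⟨t, ht⟩ : ∃ t : ℕ → ℝ, ∀ i, t i = ((⌈tk / T i⌉ : ℝ) - 1) * T i := ⟨_, fun _ => rfl⟩
  have hceil1 : ∀ i ∈ s, (1 : ℝ) ≤ (⌈tk / T i⌉ : ℝ) := fun i hi => by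
    have : 0 < ⌈tk / T i⌉ := Int.ceil_pos.mpr (div_pos htk0 (hT i hi))
    exact_mod_cast this
  have ht0 : ∀ i ∈ s, 0 ≤ t i := fun i hi => by
    rw [ht]; exact mul_nonneg (sub_nonneg.mpr (hceil1 i hi)) (hT i hi).le
  have httk : ∀ i ∈ s, t i ≤ tk := fun i hi => by
    rw [ht]
    have := Int.ceil_lt_add_one (tk / T i)
    have h2 : (⌈tk / T i⌉ : ℝ) - 1 ≤ tk / T i := by linarith
    rwa [le_div_iff₀ (hT i hi)] at h2
  obtain ⟨X, hX⟩ : ∃ X, X = (h : ℝ) * Ck + ∑ j ∈ s, U j * t j := ⟨_, rfl⟩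
  obtain ⟨V, hV⟩ : ∃ V, V = ∑ j ∈ s, U j := ⟨_, rfl⟩
  have hX0 : 0 < X := by
    have h1 : 0 ≤ ∑ j ∈ s, U j * t j :=
      Finset.sum_nonneg fun j hj => mul_nonneg (hU0 j hj) (ht0 j hj)
    have h2 : 0 < (h : ℝ) * Ck := mul_pos (by linarith) hCk
    linarith
  have hUk0 : 0 < Uk := by rw [hUk]; exact div_pos hCk hTk
  -- the bound at the end of the window
  have hA : tk < X + Tk * V := by
    refine lt_of_lt_of_le (hcon tk htk0 le_rfl) ?_
    rw [hX, hV, Finset.mul_sum, add_assoc, ← Finset.sum_add_distrib]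
    gcongr with j hj
    rw [ht, hCU j hj]
    have := mul_le_mul_of_nonneg_left (hRM j hj) (hU0 j hj)
    linarith
  -- the bound at each last release
  have hB : ∀ i ∈ s, t i ≤ X + Tk * ∑ j ∈ s, (if t j < t i then U j else 0) := by
    intro i hi
    rcases (ht0 i hi).eq_or_lt with h0 | h0
    · rw [← h0]
      have : 0 ≤ ∑ j ∈ s, (if t j < 0 then U j else 0) :=
        Finset.sum_nonneg fun j hj => by split_ifs; exacts [hU0 j hj, le_rfl]
      have := mul_nonneg hTk.le this
      linarith
    · refine (hcon (t i) h0 (httk i hi)).le.trans ?_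
      rw [hX, Finset.mul_sum, add_assoc, ← Finset.sum_add_distrib]
      gcongr with j hj
      have hle : (⌈t i / T j⌉ : ℝ) ≤ ⌈tk / T j⌉ := by
        exact_mod_cast Int.ceil_mono (div_le_div_of_nonneg_right (httk i hi) (hT j hj).le)
      split_ifs with hlt
      · have h1 := mul_le_mul_of_nonneg_left (hRM j hj) (hU0 j hj)
        have h2 := mul_le_mul_of_nonneg_right hle (hC j hj)
        refine h2.trans ?_
        rw [ht, hCU j hj]
        linarith
      · have h3 : t i / T j ≤ ((⌈tk / T j⌉ - 1 : ℤ) : ℝ) := by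
          rw [div_le_iff₀ (hT j hj)]
          push_cast
          rw [← ht]
          exact not_lt.mp hlt
        have h4 : (⌈t i / T j⌉ : ℝ) ≤ (⌈tk / T j⌉ : ℝ) - 1 := by
          exact_mod_cast Int.ceil_le.mpr h3
        have h2 := mul_le_mul_of_nonneg_right h4 (hC j hj)
        refine h2.trans ?_
        rw [ht, hCU j hj]
        linarith
  have hP := aux_pairs s t U hU0
  rw [← hV] at hP hsumU
  obtain ⟨P, hPd⟩ : ∃ P, P = ∑ i ∈ s, U i * ∑ j ∈ s, (if t j < t i then U j else 0) := ⟨_, rfl⟩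
  obtain ⟨q, hqd⟩ : ∃ q, q = ∑ i ∈ s, U i ^ 2 := ⟨_, rfl⟩
  rw [← hPd, ← hqd] at hP
  have hsum : ∑ j ∈ s, U j * t j ≤ V * X + Tk * P := by
    rw [hV, hPd, Finset.sum_mul, Finset.mul_sum, ← Finset.sum_add_distrib]
    refine Finset.sum_le_sum fun i hi => ?_
    have := mul_le_mul_of_nonneg_left (hB i hi) (hU0 i hi)
    linarith
  have hcs : V ^ 2 ≤ ((k : ℝ) - 1) * q := by
    have := sq_sum_le_card_mul_sum_sq (s := s) (f := U)
    have hcard : ((s.card : ℕ) : ℝ) = (k : ℝ) - 1 := by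
      rw [hs, Nat.card_Icc, Nat.add_sub_cancel, Nat.cast_sub (by omega)]; simp
    rw [hcard] at this
    rw [hV, hqd]; exact this
  have hV1 : 0 < 1 - V := by linarith
  have hβ0 : 0 < β := by rw [hβ]; exact div_pos hTk hD
  have hCk' : Ck = Uk * Tk := by rw [hUk, div_mul_cancel₀ _ hTk.ne']
  have hDβ : D = Tk * (1 / β) := by rw [hβ]; field_simp
  have hk1 : (2 : ℝ) ≤ k := by exact_mod_cast hk
  have hmain : (1 - V) / β + (V ^ 2 + q) / 2 < V + Uk := by
    have h1 : (tk - Tk * V) * (1 - V) < X * (1 - V) :=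
      mul_lt_mul_of_pos_right (by linarith) hV1
    have h2 : X * (1 - V) ≤ h * Ck + Tk * P := by linarith
    have h3 : Tk * P ≤ Tk * ((V ^ 2 - q) / 2) :=
      mul_le_mul_of_nonneg_left (by linarith) hTk.le
    have h4 : (tk - Tk * V) * (1 - V) < h * Ck + Tk * ((V ^ 2 - q) / 2) := by linarith
    rw [htk, hCk', hDβ] at h4
    have h5 : Tk * ((((h : ℝ) - 1) + 1 / β - V) * (1 - V))
        < Tk * (h * Uk + (V ^ 2 - q) / 2) := by linarith
    have h6 := lt_of_mul_lt_mul_left h5 hTk.le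
    have h7 : 0 ≤ ((h : ℝ) - 1) * (1 - (V + Uk)) :=
      mul_nonneg (by linarith) (by linarith)
    have h8 : (1 - V) / β = (1 / β) * (1 - V) := by ring
    rw [h8]
    linarith
  refine aux_final ((k : ℝ) - 1) β (V + Uk) V q (by linarith) hβ0 (by linarith) hcs hmain ?_
  rw [sub_add_cancel, hV]
  rcases hcond with ⟨a, b⟩ | ⟨a, b⟩
  · exact Or.inl ⟨by linarith, b⟩
  · exact Or.inr b
end
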